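/- arXiv:2106.03183 — 3 statements merged into one kernel-verified Lean document; each statement's English description precedes it below -/
import Mathlib

section
/- Let L be a lattice of rank n ≥ 6 and let (v_1,…,v_n) be any Minkowski-reduced basis of L. Then ‖v_6‖² ≤ (6/4)·λ_6(L)². -/
open scoped BigOperators
noncomputable section

/-- Euclidean space ℝ^m. -/
abbrev E (m : ℕ) := EuclideanSpace ℝ (Fin m)

/-- `L` is a lattice of rank `n` in `ℝ^m`: a discrete additive subgroup spanning an
`n`-dimensional real subspace. -/
def IsLattice {m : ℕ} (L : AddSubgroup (E m)) (n : ℕ) : Prop :=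
  DiscreteTopology L ∧ Module.finrank ℝ (Submodule.span ℝ (L : Set (E m))) = n

/-- `b` is a basis of the lattice `L`: a tuple of vectors of `L` generating `L`
as a ℤ-module. -/
def IsLatticeBasis {m n : ℕ} (L : AddSubgroup (E m)) (b : Fin n → E m) : Prop :=
  (∀ i, b i ∈ L) ∧ (Submodule.span ℤ (Set.range b) : Set (E m)) = (L : Set (E m))

/-- `b` is a primitive tuple of vectors of `L`: it is linearly independent and
`span_ℤ(b) = span_ℝ(b) ∩ L`; equivalently, it can be extended to a basis of `L`. -/
def IsPrimitiveTuple {m k : ℕ} (L : AddSubgroup (E m)) (b : Fin k → E m) : Prop :=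
  (∀ i, b i ∈ L) ∧ LinearIndependent ℝ b ∧
  (Submodule.span ℤ (Set.range b) : Set (E m)) =
    (Submodule.span ℝ (Set.range b) : Set (E m)) ∩ (L : Set (E m))

/-- The first `i` entries of the tuple `v`. -/
def truncTuple {m n : ℕ} (v : Fin n → E m) (i : Fin n) : Fin i → E m :=
  fun j => v (Fin.castLE i.isLt.le j)

/-- `v` is a Minkowski-reduced basis of `L`: it is a basis and, for each `i`, `v i` has
minimal norm among all `w ∈ L` such that `(v 0, …, v (i-1), w)` is primitive. -/
def IsMinkowskiReduced {m n : ℕ} (L : AddSubgroup (E m)) (v : Fin n → E m) : Prop :=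
  IsLatticeBasis L v ∧ ∀ i : Fin n, ∀ w ∈ L,
    IsPrimitiveTuple L (Fin.snoc (truncTuple v i) w) → ‖v i‖ ≤ ‖w‖

/-- The `i`-th successive minimum `λ_i(L)`: the least `r ≥ 0` such that `L` contains
`i` linearly independent vectors of norm at most `r`. -/
def succMin {m : ℕ} (L : AddSubgroup (E m)) (i : ℕ) : ℝ :=
  sInf {r : ℝ | 0 ≤ r ∧ ∃ v : Fin i → E m,
    (∀ j, v j ∈ L) ∧ LinearIndependent ℝ v ∧ ∀ j, ‖v j‖ ≤ r}

/-- A linearly independent finite family admits a linear coordinate map on the ambient space. -/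
lemma exists_coordinate_map {m n : ℕ} {v : Fin n → E m} (hli : LinearIndependent ℝ v) :
    ∃ g : E m →ₗ[ℝ] (Fin n → ℝ), ∀ k, g (v k) = Pi.single k 1 := by
  have hinj : LinearMap.ker (Fintype.linearCombination ℝ v) = ⊥ :=
    LinearMap.ker_eq_bot.2 hli.fintypeLinearCombination_injective
  obtain ⟨g, hg⟩ := LinearMap.exists_leftInverse_of_injective _ hinj
  refine ⟨g, fun k => ?_⟩
  have := LinearMap.congr_fun hg (Pi.single k 1)
  simpa using this

lemma IsLatticeBasis.linearIndependent {m n : ℕ} {L : AddSubgroup (E m)} {v : Fin n → E m}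
    (hL : IsLattice L n) (hb : IsLatticeBasis L v) : LinearIndependent ℝ v := by
  rw [linearIndependent_iff_card_eq_finrank_span, Fintype.card_fin]
  have h : Submodule.span ℝ (L : Set (E m)) = Submodule.span ℝ (Set.range v) := by
    rw [← hb.2, Submodule.span_span_of_tower]
  rw [Set.finrank, ← h, hL.2]

lemma IsLatticeBasis.exists_eq_sum {m n : ℕ} {L : AddSubgroup (E m)} {v : Fin n → E m}
    (hb : IsLatticeBasis L v) {x : E m} (hx : x ∈ L) :
    ∃ c : Fin n → ℤ, x = ∑ j, c j • v j := by
  have : x ∈ Submodule.span ℤ (Set.range v) := by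
    rw [← SetLike.mem_coe, hb.2]; exact hx
  obtain ⟨c, hc⟩ := (Submodule.mem_span_range_iff_exists_fun ℤ).1 this
  exact ⟨c, hc.symm⟩

lemma coordinate_sum {m n : ℕ} {v : Fin n → E m} {g : E m →ₗ[ℝ] (Fin n → ℝ)}
    (hg : ∀ k, g (v k) = Pi.single k 1) (c : Fin n → ℤ) (j : Fin n) :
    g (∑ k, c k • v k) j = c j := by
  simp [map_sum, hg, Finset.sum_apply, Pi.single_apply]

lemma coordinate_eq_zero_of_mem_span {m n : ℕ} {v : Fin n → E m} {g : E m →ₗ[ℝ] (Fin n → ℝ)}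
    (hg : ∀ k, g (v k) = Pi.single k 1) {i j : Fin n} (hij : i ≤ j) {y : E m}
    (hy : y ∈ Submodule.span ℝ (v '' Set.Iio i)) : g y j = 0 := by
  induction hy using Submodule.span_induction with
  | mem x hx =>
    obtain ⟨k, hk, rfl⟩ := hx
    have : j ≠ k := (lt_of_lt_of_le hk hij).ne'
    simp [hg, this]
  | zero => simp
  | add x y _ _ hx hy => simp [hx, hy]
  | smul a x _ hx => simp [hx]

lemma range_truncTuple {m n : ℕ} (v : Fin n → E m) (i : Fin n) :
    Set.range (truncTuple v i) = v '' Set.Iio i := by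
  ext x
  constructor
  · rintro ⟨k, rfl⟩
    exact ⟨_, by simp [Fin.lt_def], rfl⟩
  · rintro ⟨k, hk, rfl⟩
    exact ⟨⟨k, hk⟩, rfl⟩

/-- Appending to the first vectors of a lattice basis a lattice vector whose remaining coordinates
are coprime gives a primitive tuple. -/
lemma isPrimitiveTuple_snoc {m n : ℕ} {L : AddSubgroup (E m)} {v : Fin n → E m}
    (hb : IsLatticeBasis L v) (hli : LinearIndependent ℝ v) (i : Fin n) (c d : Fin n → ℤ)
    (h : ∑ j ∈ Finset.Ici i, d j * c j = 1) :
    IsPrimitiveTuple L (Fin.snoc (α := fun _ => E m) (truncTuple v i) (∑ j, c j • v j)) := by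
  obtain ⟨g, hg⟩ := exists_coordinate_map hli
  have hw : ∑ j, c j • v j ∈ L := sum_mem fun j _ => zsmul_mem (hb.1 j) _
  have hmem : ∀ k, Fin.snoc (α := fun _ => E m) (truncTuple v i) (∑ j, c j • v j) k ∈ L := by
    intro k
    induction k using Fin.lastCases with
    | last => simpa using hw
    | cast k => simpa using! hb.1 (Fin.castLE i.isLt.le k)
  have hrange : Set.range (Fin.snoc (α := fun _ => E m) (truncTuple v i) (∑ j, c j • v j)) =
      insert (∑ j, c j • v j) (v '' Set.Iio i) := by
    rw [Fin.range_snoc, range_truncTuple]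
  refine ⟨hmem, ?_, ?_⟩
  · rw [linearIndependent_finSnoc]
    refine ⟨hli.comp _ (Fin.castLE_injective _), fun hmem => ?_⟩
    rw [range_truncTuple] at hmem
    have hz : ∀ j ∈ Finset.Ici i, d j * c j = 0 := by
      intro j hj
      have := coordinate_eq_zero_of_mem_span hg (Finset.mem_Ici.1 hj) hmem
      rw [coordinate_sum hg] at this
      have hc : c j = 0 := by exact_mod_cast this
      simp [hc]
    rw [Finset.sum_eq_zero hz] at h
    exact zero_ne_one h
  · apply Set.Subset.antisymm
    · refine Set.subset_inter (Submodule.span_subset_span ℤ ℝ _) ?_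
      intro z hz
      have : Submodule.span ℤ
          (Set.range (Fin.snoc (α := fun _ => E m) (truncTuple v i) (∑ j, c j • v j))) ≤
          AddSubgroup.toIntSubmodule L := by
        rw [Submodule.span_le]
        rintro _ ⟨k, rfl⟩
        exact hmem k
      exact this hz
    · rintro z ⟨hz, hzL⟩
      rw [hrange] at hz ⊢
      obtain ⟨β, y, hy, rfl⟩ := Submodule.mem_span_insert.1 hz
      obtain ⟨e, he⟩ := hb.exists_eq_sum hzL
      have hcoord : ∀ j, i ≤ j → (e j : ℝ) = β * c j := by
        intro j hj
        have h1 := congrArg (fun z => g z j) he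
        simp only [map_add, map_smul, Pi.add_apply, Pi.smul_apply, coordinate_sum hg,
          coordinate_eq_zero_of_mem_span hg hj hy, smul_eq_mul] at h1
        linarith
      obtain ⟨b, hb'⟩ : ∃ b : ℤ, β = b := by
        refine ⟨∑ j ∈ Finset.Ici i, d j * e j, ?_⟩
        have h1 : (∑ j ∈ Finset.Ici i, (d j : ℝ) * c j) = 1 := by exact_mod_cast h
        push_cast
        rw [← mul_one β, ← h1, Finset.mul_sum]
        refine Finset.sum_congr rfl fun j hj => ?_
        rw [hcoord j (Finset.mem_Ici.1 hj)]
        ring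
      have hsum : β • ∑ j, c j • v j + y =
          b • ∑ j, c j • v j + ∑ j, (e j - b * c j) • v j := by
        rw [he, Finset.smul_sum, ← Finset.sum_add_distrib]
        refine Finset.sum_congr rfl fun j _ => ?_
        module
      rw [hsum]
      refine add_mem (Submodule.smul_mem _ _ (Submodule.subset_span (Set.mem_insert _ _)))
        (sum_mem fun j _ => ?_)
      by_cases hj : j < i
      · exact Submodule.smul_mem _ _ (Submodule.subset_span (Set.mem_insert_of_mem _ ⟨j, hj, rfl⟩))
      · have : e j - b * c j = 0 := by
          have := hcoord j (not_lt.1 hj)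
          rw [hb'] at this
          have : e j = b * c j := by exact_mod_cast this
          omega
        simp [this]

/-- Randomised rounding of coefficients: some rounding is at least as good as the average. -/
lemma exists_rounding {m : ℕ} {ι : Type*} [DecidableEq ι] (s : Finset ι) (b : ι → E m) (t : ι → ℝ)
    (ht : ∀ j, 0 ≤ t j ∧ t j ≤ 1) (w : E m) :
    ∃ ε : ι → ℤ, ‖w + ∑ j ∈ s, (t j - ε j) • b j‖ ^ 2 ≤
      ‖w‖ ^ 2 + ∑ j ∈ s, t j * (1 - t j) * ‖b j‖ ^ 2 := by
  induction s using Finset.induction_on with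
  | empty => exact ⟨0, by simp⟩
  | insert k s hk ih =>
    obtain ⟨ε, hε⟩ := ih
    set z := w + ∑ j ∈ s, (t j - ε j) • b j with hz
    have hupd : ∀ a : ℤ, w + ∑ j ∈ insert k s, (t j - (Function.update ε k a j : ℤ)) • b j =
        z + (t k - a) • b k := by
      intro a
      rw [Finset.sum_insert hk, Function.update_self, hz]
      have : ∑ j ∈ s, (t j - (Function.update ε k a j : ℤ)) • b j =
          ∑ j ∈ s, (t j - ε j) • b j := by
        refine Finset.sum_congr rfl fun j hj => ?_
        rw [Function.update_of_ne (ne_of_mem_of_not_mem hj hk)]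
      rw [this]
      abel
    have hnorm : ∀ a : ℝ, ‖z + a • b k‖ ^ 2 =
        ‖z‖ ^ 2 + 2 * a * inner ℝ z (b k) + a ^ 2 * ‖b k‖ ^ 2 := by
      intro a
      rw [norm_add_sq_real, inner_smul_right, norm_smul, mul_pow, Real.norm_eq_abs, sq_abs]
      ring
    rw [Finset.sum_insert hk]
    obtain ⟨h0, h1⟩ := ht k
    by_cases hin : inner ℝ z (b k) * 2 + (2 * t k - 1) * ‖b k‖ ^ 2 ≤ 0
    · refine ⟨Function.update ε k 0, ?_⟩
      rw [hupd, hnorm]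
      push_cast
      nlinarith [mul_nonpos_of_nonneg_of_nonpos h0 hin]
    · refine ⟨Function.update ε k 1, ?_⟩
      rw [hupd, hnorm]
      push_cast
      nlinarith [mul_nonneg (sub_nonneg.2 h1) (not_le.1 hin).le]

/-- A lattice vector `x` outside the span of the first vectors of a Minkowski-reduced basis bounds
the next basis vector, in terms of the index `p` of `x` and its residues modulo `p`. -/
lemma IsMinkowskiReduced.exists_index_bound {m n : ℕ} {L : AddSubgroup (E m)} {v : Fin n → E m}
    (hv : IsMinkowskiReduced L v) (hli : LinearIndependent ℝ v) (i : Fin n) {x : E m}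
    (hxL : x ∈ L) (hx : x ∉ Submodule.span ℝ (v '' Set.Iio i)) :
    ∃ p : ℤ, 0 < p ∧ ∃ a : Fin n → ℤ, (∀ j, 0 ≤ a j ∧ a j < p) ∧
      (∃ u ∈ L, p • u = x + ∑ j ∈ Finset.Iio i, a j • v j) ∧
      (p : ℝ) ^ 2 * ‖v i‖ ^ 2 ≤
        ‖x‖ ^ 2 + ∑ j ∈ Finset.Iio i, (a j : ℝ) * (p - a j) * ‖v j‖ ^ 2 := by
  obtain ⟨c, hc⟩ := hv.1.exists_eq_sum hxL
  have hsplit : ∀ f : Fin n → E m, ∑ j, f j =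
      ∑ j ∈ Finset.Iio i, f j + ∑ j ∈ Finset.Ici i, f j := by
    intro f
    rw [← Finset.sum_union]
    · congr 1
      ext j
      simp [lt_or_ge]
    · rw [Finset.disjoint_left]
      intro j hj hj'
      exact absurd (Finset.mem_Iio.1 hj) (not_lt.2 (Finset.mem_Ici.1 hj'))
  obtain ⟨k, hk, hck⟩ : ∃ k ∈ Finset.Ici i, c k ≠ 0 := by
    by_contra! hcon
    apply hx
    rw [hc, hsplit, Finset.sum_eq_zero (s := Finset.Ici i) (fun j hj => by simp [hcon j hj]),
      add_zero]
    refine sum_mem fun j hj => zsmul_mem (Submodule.subset_span ?_) _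
    exact Set.mem_image_of_mem v (Set.mem_Iio.2 (Finset.mem_Iio.1 hj))
  obtain ⟨c', hc', hgcd⟩ := Finset.extract_gcd (s := Finset.Ici i) c ⟨k, hk⟩
  set p : ℤ := (Finset.Ici i).gcd c with hp
  have hp0 : 0 < p := by
    have hne : p ≠ 0 := fun h => hck (Finset.gcd_eq_zero_iff.1 h k hk)
    have hnn : 0 ≤ p := by
      rw [hp, ← Finset.normalize_gcd]
      exact Int.nonneg_of_normalize_eq_self (normalize_idem _)
    omega
  obtain ⟨d, hd⟩ := Finset.gcd_eq_sum_mul (Finset.Ici i) c'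
  have hpR : (0 : ℝ) < p := by exact_mod_cast hp0
  set a : Fin n → ℤ := fun j => (-c j) % p with ha
  have ha' : ∀ j, 0 ≤ a j ∧ a j < p := fun j =>
    ⟨Int.emod_nonneg _ hp0.ne', Int.emod_lt_of_pos _ hp0⟩
  set q : Fin n → ℤ := fun j => (-c j) / p with hq
  have hqa : ∀ j, c j = -(p * q j + a j) := fun j => by
    have := Int.mul_ediv_add_emod (-c j) p
    simp only [ha, hq]; omega
  set u : E m := ∑ j ∈ Finset.Ici i, c' j • v j - ∑ j ∈ Finset.Iio i, q j • v j with hu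
  have huL : u ∈ L := sub_mem (sum_mem fun j _ => zsmul_mem (hv.1.1 j) _)
    (sum_mem fun j _ => zsmul_mem (hv.1.1 j) _)
  have hpu : p • u = x + ∑ j ∈ Finset.Iio i, a j • v j := by
    rw [hc, hsplit, hu, smul_sub, Finset.smul_sum, Finset.smul_sum]
    have h1 : ∑ j ∈ Finset.Ici i, p • c' j • v j = ∑ j ∈ Finset.Ici i, c j • v j :=
      Finset.sum_congr rfl fun j hj => by rw [smul_smul, ← hc' j hj]
    have h2 : ∑ j ∈ Finset.Iio i, c j • v j =
        -(∑ j ∈ Finset.Iio i, p • q j • v j + ∑ j ∈ Finset.Iio i, a j • v j) := by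
      rw [← Finset.sum_add_distrib, ← Finset.sum_neg_distrib]
      refine Finset.sum_congr rfl fun j _ => ?_
      rw [hqa j]
      module
    rw [h1, h2]
    abel
  refine ⟨p, hp0, a, ha', ⟨u, huL, hpu⟩, ?_⟩
  obtain ⟨ε, hε⟩ := exists_rounding (Finset.Iio i) v (fun j => (a j : ℝ) / p)
    (fun j => ⟨div_nonneg (by exact_mod_cast (ha' j).1) hpR.le,
      (div_le_one hpR).2 (by exact_mod_cast (ha' j).2.le)⟩) ((p : ℝ)⁻¹ • x)
  have hpuR : (p : ℝ) • u = x + ∑ j ∈ Finset.Iio i, (a j : ℝ) • v j := by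
    simpa only [Int.cast_smul_eq_zsmul] using hpu
  have hround : (p : ℝ)⁻¹ • x + ∑ j ∈ Finset.Iio i, ((a j : ℝ) / p - ε j) • v j =
      ∑ j, (if i ≤ j then c' j else - q j - ε j) • v j := by
    have h1 : (p : ℝ)⁻¹ • x + ∑ j ∈ Finset.Iio i, ((a j : ℝ) / p) • v j = u := by
      have : u = (p : ℝ)⁻¹ • ((p : ℝ) • u) := by rw [smul_smul, inv_mul_cancel₀ hpR.ne', one_smul]
      rw [this, hpuR, smul_add, Finset.smul_sum]
      congr 1
      refine Finset.sum_congr rfl fun j _ => ?_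
      rw [smul_smul, div_eq_inv_mul]
    have h2 : ∑ j ∈ Finset.Iio i, (if i ≤ j then c' j else - q j - ε j) • v j =
        -(∑ j ∈ Finset.Iio i, q j • v j) - ∑ j ∈ Finset.Iio i, (ε j : ℝ) • v j := by
      rw [← Finset.sum_neg_distrib, ← Finset.sum_sub_distrib]
      refine Finset.sum_congr rfl fun j hj => ?_
      rw [if_neg (not_le.2 (Finset.mem_Iio.1 hj))]
      module
    have h3 : ∑ j ∈ Finset.Ici i, (if i ≤ j then c' j else - q j - ε j) • v j =
        ∑ j ∈ Finset.Ici i, c' j • v j :=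
      Finset.sum_congr rfl fun j hj => by rw [if_pos (Finset.mem_Ici.1 hj)]
    simp only [sub_smul, Finset.sum_sub_distrib]
    rw [hsplit, h2, h3, ← add_sub_assoc, h1, hu]
    abel
  have hle : ‖v i‖ ≤ ‖(p : ℝ)⁻¹ • x + ∑ j ∈ Finset.Iio i, ((a j : ℝ) / p - ε j) • v j‖ := by
    rw [hround]
    refine hv.2 i _ (sum_mem fun j _ => zsmul_mem (hv.1.1 j) _)
      (isPrimitiveTuple_snoc hv.1 hli i _ d ?_)
    rw [← hgcd, hd]
    refine Finset.sum_congr rfl fun j hj => ?_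
    rw [if_pos (Finset.mem_Ici.1 hj), mul_comm]
  have hsq := (pow_le_pow_left₀ (norm_nonneg _) hle 2).trans hε
  have hmul := mul_le_mul_of_nonneg_left hsq (sq_nonneg (p : ℝ))
  refine hmul.trans (le_of_eq ?_)
  rw [mul_add, norm_smul, mul_pow, Real.norm_eq_abs, sq_abs, Finset.mul_sum]
  congr 1
  · field_simp
  · refine Finset.sum_congr rfl fun j _ => ?_
    field_simp

lemma IsMinkowskiReduced.norm_sq_le {m n : ℕ} {L : AddSubgroup (E m)} {v : Fin n → E m}
    (hv : IsMinkowskiReduced L v) (hli : LinearIndependent ℝ v) (i : Fin n) {x : E m} {r : ℝ}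
    (hxL : x ∈ L) (hx : x ∉ Submodule.span ℝ (v '' Set.Iio i)) (hxr : ‖x‖ ≤ r)
    (hvr : ∀ j < i, ‖v j‖ ≤ r) :
    ‖v i‖ ^ 2 ≤ max 1 ((1 + (i : ℕ)) / 4 : ℝ) * r ^ 2 := by
  obtain ⟨p, hp0, a, ha, -, hbound⟩ := hv.exists_index_bound hli i hxL hx
  have hr : 0 ≤ r := (norm_nonneg _).trans hxr
  have hx2 : ‖x‖ ^ 2 ≤ r ^ 2 := pow_le_pow_left₀ (norm_nonneg _) hxr 2
  rcases (show p = 1 ∨ 2 ≤ p by omega) with rfl | hp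
  · have : ∀ j ∈ Finset.Iio i, (a j : ℝ) * ((1 : ℤ) - a j) * ‖v j‖ ^ 2 = 0 := by
      intro j _
      have : a j = 0 := by have := ha j; omega
      simp [this]
    rw [Finset.sum_eq_zero this] at hbound
    have h1 := mul_le_mul_of_nonneg_right
      (le_max_left (1 : ℝ) ((1 + (i : ℕ)) / 4 : ℝ)) (sq_nonneg r)
    norm_num at hbound
    linarith
  · have hpR : (2 : ℝ) ≤ p := by exact_mod_cast hp
    have hsum : ∑ j ∈ Finset.Iio i, (a j : ℝ) * (p - a j) * ‖v j‖ ^ 2 ≤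
        ∑ j ∈ Finset.Iio i, (p : ℝ) ^ 2 / 4 * r ^ 2 := by
      refine Finset.sum_le_sum fun j hj => ?_
      refine mul_le_mul ?_ (pow_le_pow_left₀ (norm_nonneg _) (hvr j (Finset.mem_Iio.1 hj)) 2)
        (sq_nonneg _) (by positivity)
      nlinarith [sq_nonneg ((p : ℝ) - 2 * a j)]
    rw [Finset.sum_const, Fin.card_Iio, nsmul_eq_mul] at hsum
    have h1 := mul_le_mul_of_nonneg_right
      (le_max_right (1 : ℝ) ((1 + (i : ℕ)) / 4 : ℝ)) (sq_nonneg r)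
    refine le_trans ?_ h1
    have hp4 : (4 : ℝ) ≤ (p : ℝ) ^ 2 := by nlinarith
    have h2 : (p : ℝ) ^ 2 * ‖v i‖ ^ 2 ≤ (p : ℝ) ^ 2 * ((1 + (i : ℕ)) / 4 * r ^ 2) := by
      nlinarith [mul_le_mul_of_nonneg_right hp4 (sq_nonneg r)]
    exact le_of_mul_le_mul_left h2 (by positivity)

/-- If the fifth vector of a Minkowski-reduced basis is longer than `r`, every lattice vector of
norm at most `r` outside the span of the first four is a positive multiple of one that is
congruent to the sum of the first four modulo `2 L`. -/
lemma IsMinkowskiReduced.exists_half {m n : ℕ} {L : AddSubgroup (E m)} {v : Fin n → E m}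
    (hv : IsMinkowskiReduced L v) (hli : LinearIndependent ℝ v) (i : Fin n) (hi : (i : ℕ) = 4)
    {x : E m} {r : ℝ} (hxL : x ∈ L) (hx : x ∉ Submodule.span ℝ (v '' Set.Iio i)) (hxr : ‖x‖ ≤ r)
    (hvr : ∀ j < i, ‖v j‖ ≤ r) (hlt : r < ‖v i‖) :
    ∃ k : ℤ, 0 < k ∧ ∃ u ∈ L, x = k • ((2 : ℤ) • u - ∑ j ∈ Finset.Iio i, v j) := by
  obtain ⟨p, hp0, a, ha, ⟨u, huL, hpu⟩, hbound⟩ := hv.exists_index_bound hli i hxL hx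
  have hr : 0 ≤ r := (norm_nonneg _).trans hxr
  have hpR : (0 : ℝ) < p := by exact_mod_cast hp0
  have hsum : ∑ j ∈ Finset.Iio i, (a j : ℝ) * (p - a j) * ‖v j‖ ^ 2 ≤
      ∑ j ∈ Finset.Iio i, (a j : ℝ) * (p - a j) * r ^ 2 := by
    refine Finset.sum_le_sum fun j hj => ?_
    refine mul_le_mul_of_nonneg_left
      (pow_le_pow_left₀ (norm_nonneg _) (hvr j (Finset.mem_Iio.1 hj)) 2) (mul_nonneg ?_ ?_)
    · exact_mod_cast (ha j).1
    · have : (a j : ℝ) ≤ p := by exact_mod_cast (ha j).2.le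
      linarith
  rw [← Finset.sum_mul] at hsum
  have hx2 : ‖x‖ ^ 2 ≤ r ^ 2 := pow_le_pow_left₀ (norm_nonneg _) hxr 2
  have hr2 : (p : ℝ) ^ 2 * r ^ 2 < (p : ℝ) ^ 2 * ‖v i‖ ^ 2 :=
    mul_lt_mul_of_pos_left (pow_lt_pow_left₀ hlt hr two_ne_zero) (by positivity)
  have hlt2 : (p : ℝ) ^ 2 < 1 + ∑ j ∈ Finset.Iio i, (a j : ℝ) * (p - a j) := by
    refine lt_of_mul_lt_mul_right ?_ (sq_nonneg r)
    linarith
  have hltZ : p ^ 2 < 1 + ∑ j ∈ Finset.Iio i, a j * (p - a j) := by exact_mod_cast hlt2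
  have hcard : (Finset.Iio i).card = 4 := by rw [Fin.card_Iio, hi]
  have hsq : ∑ j ∈ Finset.Iio i, (p - 2 * a j) ^ 2 < 4 := by
    have : ∑ j ∈ Finset.Iio i, (p - 2 * a j) ^ 2 =
        4 * p ^ 2 - 4 * ∑ j ∈ Finset.Iio i, a j * (p - a j) := by
      have h4 : 4 * p ^ 2 = ∑ j ∈ Finset.Iio i, p ^ 2 := by
        rw [Finset.sum_const, hcard]; simp
      rw [h4, Finset.mul_sum, ← Finset.sum_sub_distrib]
      exact Finset.sum_congr rfl fun j _ => by ring
    linarith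
  have heven : p % 2 = 0 := by
    by_contra hodd
    have : ∑ j ∈ Finset.Iio i, (1 : ℤ) ≤ ∑ j ∈ Finset.Iio i, (p - 2 * a j) ^ 2 := by
      refine Finset.sum_le_sum fun j _ => ?_
      have : p - 2 * a j ≠ 0 := by omega
      have := sq_pos_of_ne_zero this
      omega
    rw [Finset.sum_const, hcard] at this
    norm_num at this
    omega
  obtain ⟨k, rfl⟩ : ∃ k, p = 2 * k := ⟨p / 2, by omega⟩
  have hak : ∀ j ∈ Finset.Iio i, a j = k := by
    intro j hj
    have h1 := (Finset.single_le_sum (f := fun j => (2 * k - 2 * a j) ^ 2)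
      (fun j _ => sq_nonneg _) hj).trans_lt hsq
    have h2 : (k - a j) ^ 2 < 1 := by
      nlinarith
    have := pow_eq_zero_iff (two_ne_zero) |>.1 (le_antisymm (by omega) (sq_nonneg (k - a j)))
    omega
  refine ⟨k, by omega, u, huL, ?_⟩
  have h1 : ∑ j ∈ Finset.Iio i, a j • v j = k • ∑ j ∈ Finset.Iio i, v j := by
    rw [Finset.smul_sum]
    exact Finset.sum_congr rfl fun j hj => by rw [hak j hj]
  rw [h1] at hpu
  rw [smul_sub, smul_smul, mul_comm, hpu]
  abel

lemma exists_norm_minimal_notMem {m : ℕ} (L : AddSubgroup (E m)) [DiscreteTopology L]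
    (V : Submodule ℝ (E m)) {w : E m} (hw : w ∈ L) (hwV : w ∉ V) :
    ∃ x ∈ L, x ∉ V ∧ ∀ y ∈ L, y ∉ V → ‖x‖ ≤ ‖y‖ := by
  have hfin : (Metric.closedBall (0 : E m) ‖w‖ ∩ (L : Set (E m))).Finite :=
    Metric.finite_isBounded_inter_isClosed DiscreteTopology.isDiscrete Metric.isBounded_closedBall
      AddSubgroup.isClosed_of_discrete
  obtain ⟨x, ⟨⟨hxw, hxL⟩, hxV⟩, hmin⟩ := Set.exists_min_image
    ((Metric.closedBall (0 : E m) ‖w‖ ∩ (L : Set (E m))) ∩ {y | y ∉ V}) norm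
    (hfin.subset Set.inter_subset_left) ⟨w, ⟨by simp, hw⟩, hwV⟩
  refine ⟨x, hxL, hxV, fun y hy hyV => ?_⟩
  by_cases hyw : ‖y‖ ≤ ‖w‖
  · exact hmin y ⟨⟨by simpa using hyw, hy⟩, hyV⟩
  · exact le_trans (by simpa using hxw) (not_le.1 hyw).le

lemma exists_notMem_of_finrank_lt {m k : ℕ} {w : Fin k → E m} (hw : LinearIndependent ℝ w)
    (V : Submodule ℝ (E m)) (hV : Module.finrank ℝ V < k) : ∃ j, w j ∉ V := by
  by_contra! hcon
  have h1 : Submodule.span ℝ (Set.range w) ≤ V := by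
    rw [Submodule.span_le]
    rintro _ ⟨j, rfl⟩
    exact hcon j
  have h2 := Submodule.finrank_mono h1
  rw [finrank_span_eq_card hw, Fintype.card_fin] at h2
  omega

lemma finrank_span_image_Iio_le {m n : ℕ} (v : Fin n → E m) (i : Fin n) :
    Module.finrank ℝ (Submodule.span ℝ (v '' Set.Iio i)) ≤ i := by
  rw [← range_truncTuple]
  exact (finrank_range_le_card _).trans (by simp)

/-- The fifth vector of a Minkowski-reduced basis is at most as long as the longest of any six
linearly independent lattice vectors. -/
lemma IsMinkowskiReduced.norm_fifth_le {m n : ℕ} {L : AddSubgroup (E m)} [DiscreteTopology L]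
    {v : Fin n → E m} (hv : IsMinkowskiReduced L v) (hli : LinearIndependent ℝ v) (i : Fin n)
    (hi : (i : ℕ) = 4) {r : ℝ} (hvr : ∀ j < i, ‖v j‖ ≤ r) {w : Fin 6 → E m} (hwL : ∀ j, w j ∈ L)
    (hw : LinearIndependent ℝ w) (hwr : ∀ j, ‖w j‖ ≤ r) : ‖v i‖ ≤ r := by
  by_contra! hlt
  set V := Submodule.span ℝ (v '' Set.Iio i) with hV
  have hVrank : Module.finrank ℝ V ≤ 4 := hi ▸ finrank_span_image_Iio_le v i
  obtain ⟨j, hj⟩ := exists_notMem_of_finrank_lt hw V (by omega)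
  obtain ⟨x, hxL, hxV, hxmin⟩ := exists_norm_minimal_notMem L V (hwL j) hj
  set V' := V ⊔ Submodule.span ℝ {x} with hV'
  have hV'rank : Module.finrank ℝ V' ≤ 5 := by
    have h1 := Submodule.finrank_add_le_finrank_add_finrank V (Submodule.span ℝ {x})
    have h2 := finrank_span_le_card (R := ℝ) ({x} : Set (E m))
    simp only [Set.toFinset_singleton, Finset.card_singleton] at h2
    exact h1.trans (by omega)
  obtain ⟨j', hj'⟩ := exists_notMem_of_finrank_lt hw V' (by omega)
  obtain ⟨x', hx'L, hx'V', hx'min⟩ := exists_norm_minimal_notMem L V' (hwL j') hj'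
  have hVV' : V ≤ V' := le_sup_left
  have hxV' : x ∈ V' := Submodule.mem_sup_right (Submodule.mem_span_singleton_self x)
  have hx'V : x' ∉ V := fun h => hx'V' (hVV' h)
  set s := ∑ j ∈ Finset.Iio i, v j with hs
  have hsL : s ∈ L := sum_mem fun j _ => hv.1.1 j
  have half : ∀ (U : Submodule ℝ (E m)) (y : E m), y ∈ L → y ∉ V → y ∉ U → ‖y‖ ≤ r →
      (∀ z ∈ L, z ∉ U → ‖y‖ ≤ ‖z‖) → ∃ u ∈ L, y = (2 : ℤ) • u - s := by
    intro U y hyL hyV hyU hyr hymin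
    obtain ⟨k, hk, u, huL, hu⟩ := hv.exists_half hli i hi hyL hyV hyr hvr hlt
    refine ⟨u, huL, ?_⟩
    set z := (2 : ℤ) • u - s with hz
    have hzL : z ∈ L := sub_mem (zsmul_mem huL _) hsL
    have hzU : z ∉ U := fun h => hyU (hu ▸ zsmul_mem h k)
    have hle := hymin z hzL hzU
    have hz0 : 0 < ‖z‖ := norm_pos_iff.2 fun h => hzU (h ▸ zero_mem U)
    rw [hu, ← Int.cast_smul_eq_zsmul ℝ, norm_smul, Real.norm_eq_abs] at hle
    have hk1 : |(k : ℝ)| ≤ 1 := by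
      refine le_of_mul_le_mul_right ?_ hz0
      linarith
    have hk2 : k ≤ 1 := by exact_mod_cast (le_abs_self _).trans hk1
    rw [hu, show k = 1 by omega, one_smul]
  obtain ⟨u, huL, hu⟩ := half V x hxL hxV hxV ((hxmin _ (hwL j) hj).trans (hwr j)) hxmin
  obtain ⟨u', hu'L, hu'⟩ :=
    half V' x' hx'L hx'V hx'V' ((hx'min _ (hwL j') hj').trans (hwr j')) hx'min
  have hz1 : (2 : ℝ) • (u - u') = x - x' := by rw [hu, hu']; module
  have hz2 : (2 : ℝ) • (u + u' - s) = x + x' := by rw [hu, hu']; module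
  have h1 : ‖x'‖ ≤ ‖u - u'‖ := by
    refine hx'min _ (sub_mem huL hu'L) fun h => hx'V' ?_
    have := V'.sub_mem hxV' (hz1 ▸ V'.smul_mem (2 : ℝ) h)
    simpa using this
  have h2 : ‖x'‖ ≤ ‖u + u' - s‖ := by
    refine hx'min _ (sub_mem (add_mem huL hu'L) hsL) fun h => hx'V' ?_
    have := V'.sub_mem (hz2 ▸ V'.smul_mem (2 : ℝ) h) hxV'
    simpa using this
  have h3 : ‖x‖ ≤ ‖x'‖ := hxmin _ hx'L hx'V
  have hx0 : 0 < ‖x‖ := norm_pos_iff.2 fun h => hxV (h ▸ zero_mem V)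
  have hn1 : 2 * ‖u - u'‖ = ‖x - x'‖ := by rw [← hz1, norm_smul]; norm_num
  have hn2 : 2 * ‖u + u' - s‖ = ‖x + x'‖ := by rw [← hz2, norm_smul]; norm_num
  have hpar := parallelogram_law_with_norm ℝ x x'
  rw [← hn1, ← hn2] at hpar
  nlinarith [mul_self_le_mul_self (norm_nonneg _) h1, mul_self_le_mul_self (norm_nonneg _) h2,
    mul_self_le_mul_self (norm_nonneg _) h3]

lemma IsMinkowskiReduced.norm_sixth_sq_le {m n : ℕ} {L : AddSubgroup (E m)} [DiscreteTopology L]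
    {v : Fin n → E m} (hv : IsMinkowskiReduced L v) (hli : LinearIndependent ℝ v) (i : Fin n)
    (hi : (i : ℕ) = 5) {r : ℝ} {w : Fin 6 → E m} (hwL : ∀ j, w j ∈ L)
    (hw : LinearIndependent ℝ w) (hwr : ∀ j, ‖w j‖ ≤ r) : ‖v i‖ ^ 2 ≤ 6 / 4 * r ^ 2 := by
  have hr : 0 ≤ r := (norm_nonneg _).trans (hwr 0)
  have hbound : ∀ j : Fin n, (j : ℕ) < 6 → (∀ k < j, ‖v k‖ ≤ r) →
      ‖v j‖ ^ 2 ≤ max 1 ((1 + (j : ℕ)) / 4 : ℝ) * r ^ 2 := by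
    intro j hj hlt
    obtain ⟨l, hl⟩ := exists_notMem_of_finrank_lt hw (Submodule.span ℝ (v '' Set.Iio j))
      ((finrank_span_image_Iio_le v j).trans_lt hj)
    exact hv.norm_sq_le hli j (hwL l) hl (hwr l) hlt
  have hsmall : ∀ N : ℕ, N ≤ 4 → ∀ j : Fin n, (j : ℕ) = N → ‖v j‖ ≤ r := by
    intro N
    induction N using Nat.strong_induction_on with
    | _ N ih =>
      intro hN j hj
      have hlt : ∀ k < j, ‖v k‖ ≤ r := fun k hk =>
        ih k (by rw [← hj]; exact hk) (by have : (k : ℕ) < j := hk; omega) k rfl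
      rcases hN.eq_or_lt with h4 | h4
      · exact hv.norm_fifth_le hli j (by omega) hlt hwL hw hwr
      · have h := hbound j (by omega) hlt
        have hj3 : ((j : ℕ) : ℝ) ≤ 3 := by exact_mod_cast (show (j : ℕ) ≤ 3 by omega)
        rw [max_eq_left (by linarith), one_mul] at h
        exact le_of_sq_le_sq h hr
  have h := hbound i (by omega) fun k hk =>
    hsmall k (by have : (k : ℕ) < i := hk; omega) k rfl
  rw [hi] at h
  norm_num at h ⊢
  exact h

/-- If `L` is a lattice of rank `n ≥ 6` and `v` is any Minkowski-reduced
basis of `L`, then `‖v_6‖² ≤ (6/4)·λ_6(L)²`. -/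
theorem minkowski_sixth_vector_bound {m n : ℕ} (L : AddSubgroup (E m))
    (hL : IsLattice L n) (hn : 6 ≤ n) (v : Fin n → E m)
    (hv : IsMinkowskiReduced L v) :
    ‖v ⟨5, by omega⟩‖ ^ 2 ≤ (6 / 4 : ℝ) * (succMin L 6) ^ 2 := by
  have := hL.1
  have hli := IsLatticeBasis.linearIndependent hL hv.1
  have h0 : (0 : ℝ) < √(6 / 4) := Real.sqrt_pos.2 (by norm_num)
  have hle : ‖v ⟨5, by omega⟩‖ / √(6 / 4) ≤ succMin L 6 := by
    refine le_csInf ?_ ?_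
    · exact ⟨∑ j : Fin n, ‖v j‖, Finset.sum_nonneg fun _ _ => norm_nonneg _,
        v ∘ Fin.castLE hn, fun j => hv.1.1 _, hli.comp _ (Fin.castLE_injective _),
        fun j => Finset.single_le_sum (f := fun j => ‖v j‖) (fun _ _ => norm_nonneg _)
          (Finset.mem_univ _)⟩
    · rintro r ⟨hr, w, hwL, hw, hwr⟩
      rw [div_le_iff₀ h0]
      refine le_of_sq_le_sq ?_ (by positivity)
      rw [mul_pow, Real.sq_sqrt (by norm_num), mul_comm]
      exact hv.norm_sixth_sq_le hli _ rfl hwL hw hwr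
  have hsq := pow_le_pow_left₀ (by positivity) hle 2
  rw [div_pow, Real.sq_sqrt (by norm_num), div_le_iff₀ (by norm_num)] at hsq
  linarith
end
end

section
/- Let m ≥ 2 be an integer, let s = e_1 + ⋯ + e_m ∈ ℝ^m, and let M ⊂ ℝ^m be the ℤ-span of the vectors m·e_i − s for i = 1,…,m. Then every nonzero vector w ∈ M satisfies ‖w‖² ≥ m(m−1), and equality holds if and only if w = ±(m·e_q − s) for some 1 ≤ q ≤ m. -/
open scoped BigOperators
noncomputable section

open Finset

lemma exists_eq_single_of_idempotent_of_sum_eq_one {ι : Type*} [Fintype ι] [DecidableEq ι]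
    {d : ι → ℤ} (hd : ∀ i, d i ^ 2 = d i) (hsum : ∑ i, d i = 1) :
    ∃ q, d = Pi.single q 1 := by
  have hnonneg : ∀ i, 0 ≤ d i := fun i => hd i ▸ sq_nonneg (d i)
  obtain ⟨q, -, hq⟩ : ∃ q ∈ univ, d q ≠ 0 := exists_ne_zero_of_sum_ne_zero (by simp [hsum])
  have hq1 : d q = 1 := by
    have h : d q * (d q - 1) = 0 := by linear_combination hd q
    have := (mul_eq_zero.mp h).resolve_left hq
    lia
  refine ⟨q, funext fun i => ?_⟩
  by_cases hi : i = q
  · simp [hi, hq1]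
  · have h := add_sum_erase univ d (mem_univ q)
    have h0 : ∑ j ∈ univ.erase q, d j = 0 := by lia
    rw [sum_eq_zero_iff_of_nonneg fun j _ => hnonneg j] at h0
    simp [hi, h0 i (by simp [hi])]

lemma sum_le_sum_sq {ι : Type*} [Fintype ι] (c : ι → ℤ) : ∑ i, c i ≤ ∑ i, c i ^ 2 :=
  sum_le_sum fun i _ => Int.le_self_sq (c i)

lemma sum_sq_pos {ι : Type*} [Fintype ι] {c : ι → ℤ} (hc : c ≠ 0) : 0 < ∑ i, c i ^ 2 := by
  obtain ⟨i, hi⟩ := Function.ne_iff.mp hc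
  exact sum_pos' (fun i _ => sq_nonneg (c i)) ⟨i, mem_univ i, sq_pos_of_ne_zero hi⟩

/-- The integral quadratic form `m ∑ cᵢ² - (∑ cᵢ)²` is at least `m - 1` on nonzero vectors whose
coordinate sum is reduced modulo `m`. -/
lemma sub_one_le_mul_sum_sq_sub_sq_sum {m : ℕ} {c : Fin m → ℤ} (hc : c ≠ 0)
    (h0 : 0 ≤ ∑ i, c i) (h1 : ∑ i, c i < m) :
    (m : ℤ) - 1 ≤ m * ∑ i, c i ^ 2 - (∑ i, c i) ^ 2 := by
  have hle := sum_le_sum_sq c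
  rcases h0.eq_or_lt with h | h
  · have hpos := sum_sq_pos hc
    rw [← h]
    nlinarith
  · nlinarith [mul_nonneg (by lia : 0 ≤ ∑ i, c i - 1) (by lia : 0 ≤ (m : ℤ) - 1 - ∑ i, c i)]

lemma eq_single_or_eq_one_sub_single {m : ℕ} {c : Fin m → ℤ} (hc : c ≠ 0)
    (h0 : 0 ≤ ∑ i, c i) (h1 : ∑ i, c i < m)
    (heq : m * ∑ i, c i ^ 2 - (∑ i, c i) ^ 2 = (m : ℤ) - 1) :
    ∃ q, c = Pi.single q 1 ∨ c = 1 - Pi.single q 1 := by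
  have hle := sum_le_sum_sq c
  have hS : 0 < ∑ i, c i := by
    refine h0.lt_of_ne fun h => ?_
    have hpos := sum_sq_pos hc
    rw [← h] at heq
    nlinarith
  have hprod := mul_nonneg (by lia : 0 ≤ ∑ i, c i - 1) (by lia : 0 ≤ (m : ℤ) - 1 - ∑ i, c i)
  have hsq : ∑ i, c i = ∑ i, c i ^ 2 := by nlinarith
  have hidem : ∀ i, c i ^ 2 = c i := fun i =>
    ((sum_eq_sum_iff_of_le fun i _ => Int.le_self_sq (c i)).mp hsq i (mem_univ i)).symm
  have hzero : (∑ i, c i - 1) * ((m : ℤ) - 1 - ∑ i, c i) = 0 := by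
    rw [← hsq] at heq
    linear_combination heq
  rcases mul_eq_zero.mp hzero with h | h
  · obtain ⟨q, hq⟩ := exists_eq_single_of_idempotent_of_sum_eq_one hidem (by lia)
    exact ⟨q, Or.inl hq⟩
  · obtain ⟨q, hq⟩ := exists_eq_single_of_idempotent_of_sum_eq_one (d := 1 - c)
      (fun i => by simp only [Pi.sub_apply, Pi.one_apply]; linear_combination hidem i)
      (by simp only [Pi.sub_apply, Pi.one_apply, sum_sub_distrib]; simp; lia)
    exact ⟨q, Or.inr (by rw [← hq]; abel)⟩

lemma scaled_simplex_vector_apply {m : ℕ} (q i : Fin m) :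
    ((m : ℝ) • EuclideanSpace.single q 1 - ∑ j : Fin m, EuclideanSpace.single j (1 : ℝ) : E m) i =
      m * (Pi.single q 1 : Fin m → ℤ) i - 1 := by
  simp [Pi.single_apply]

/-- The coefficients of a vector in the span can be chosen with sum reduced modulo `m`. -/
lemma exists_reduced_coeffs {m : ℕ} (hm : 0 < m) {w : E m}
    (hw : w ∈ Submodule.span ℤ (Set.range (fun i : Fin m =>
      (m : ℝ) • EuclideanSpace.single i 1 - ∑ j : Fin m, EuclideanSpace.single j (1 : ℝ)))) :
    ∃ c : Fin m → ℤ, 0 ≤ ∑ i, c i ∧ ∑ i, c i < m ∧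
      ∀ i, w i = m * (c i : ℝ) - ((∑ j, c j : ℤ) : ℝ) := by
  obtain ⟨b, rfl⟩ := (Submodule.mem_span_range_iff_exists_fun ℤ).mp hw
  have hm' : (0 : ℤ) < m := by exact_mod_cast hm
  have hsum : ∑ i, (b i - (∑ j, b j) / m) = (∑ j, b j) % m := by
    rw [sum_sub_distrib, Int.emod_def]
    simp
  refine ⟨fun i => b i - (∑ j, b j) / m, ?_, ?_, fun i => ?_⟩
  · rw [hsum]
    exact Int.emod_nonneg _ hm'.ne'
  · rw [hsum]
    exact Int.emod_lt_of_pos _ hm'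
  · rw [hsum, Int.emod_def, WithLp.ofLp_sum, Finset.sum_apply]
    simp only [PiLp.smul_apply, scaled_simplex_vector_apply, zsmul_eq_mul, mul_sub, mul_one,
      sum_sub_distrib]
    simp [Pi.single_apply]
    ring

lemma norm_sq_eq_of_coeffs {m : ℕ} {w : E m} {c : Fin m → ℤ}
    (hw : ∀ i, w i = m * (c i : ℝ) - ((∑ j, c j : ℤ) : ℝ)) :
    ‖w‖ ^ 2 = m * ((m * ∑ i, c i ^ 2 - (∑ i, c i) ^ 2 : ℤ) : ℝ) := by
  rw [EuclideanSpace.real_norm_sq_eq]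
  simp only [hw, sub_sq, sum_add_distrib, sum_sub_distrib, mul_pow, ← sum_mul, ← mul_sum]
  push_cast
  simp
  ring

/-- For `m ≥ 2`, let `s = e_1 + ⋯ + e_m` and let `M` be the ℤ-span of the
vectors `m·e_i − s`. Then every nonzero `w ∈ M` has `‖w‖² ≥ m(m−1)`, with equality iff
`w = ±(m·e_q − s)` for some `q`. -/
theorem span_scaled_simplex_shortest_vectors (m : ℕ) (hm : 2 ≤ m) (w : E m)
    (hw : w ∈ Submodule.span ℤ (Set.range (fun i : Fin m =>
      (m : ℝ) • EuclideanSpace.single i 1 - ∑ j : Fin m, EuclideanSpace.single j (1 : ℝ))))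
    (hw0 : w ≠ 0) :
    ((m : ℝ) * ((m : ℝ) - 1)) ≤ ‖w‖ ^ 2 ∧
    (‖w‖ ^ 2 = (m : ℝ) * ((m : ℝ) - 1) ↔
      ∃ q : Fin m,
        w = (m : ℝ) • EuclideanSpace.single q 1 - ∑ j : Fin m, EuclideanSpace.single j (1 : ℝ) ∨
        w = -((m : ℝ) • EuclideanSpace.single q 1 -
              ∑ j : Fin m, EuclideanSpace.single j (1 : ℝ))) := by
  have hm0 : (0 : ℝ) < m := by positivity
  obtain ⟨c, h0, h1, hcw⟩ := exists_reduced_coeffs (by lia) hw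
  have hc : c ≠ 0 := by
    rintro rfl
    exact hw0 (by ext i; simp [hcw])
  have hnorm := norm_sq_eq_of_coeffs hcw
  refine ⟨?_, fun heq => ?_, ?_⟩
  · rw [hnorm]
    gcongr
    exact_mod_cast sub_one_le_mul_sum_sq_sub_sq_sum hc h0 h1
  · rw [hnorm] at heq
    have hform := mul_left_cancel₀ hm0.ne' heq
    obtain ⟨q, rfl | rfl⟩ := eq_single_or_eq_one_sub_single hc h0 h1 (by exact_mod_cast hform)
    · refine ⟨q, Or.inl ?_⟩
      ext i
      rw [scaled_simplex_vector_apply, hcw]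
      simp
    · refine ⟨q, Or.inr ?_⟩
      ext i
      rw [PiLp.neg_apply, scaled_simplex_vector_apply, hcw]
      simp
      ring
  · have hsimplex (q : Fin m) : ‖((m : ℝ) • EuclideanSpace.single q 1 -
        ∑ j : Fin m, EuclideanSpace.single j (1 : ℝ) : E m)‖ ^ 2 = m * ((m : ℝ) - 1) := by
      rw [norm_sq_eq_of_coeffs (c := Pi.single q 1) fun i => by
        rw [scaled_simplex_vector_apply]; simp]
      simp [Pi.single_apply]
    rintro ⟨q, rfl | rfl⟩
    · exact hsimplex q
    · rw [norm_neg]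
      exact hsimplex q
end
end

section
/- Let n ≥ 5. Then every nonzero vector of D_n^* has norm at least 1, λ_i(D_n^*) = 1 for all 1 ≤ i ≤ n, and every Minkowski-reduced basis (v_1,…,v_n) of D_n^* satisfies ‖v_n‖² = n/4 = (n/4)·λ_n(D_n^*)². -/
open scoped BigOperators
noncomputable section

/-- The lattice `D_n^* = span_ℤ(e_1, …, e_{n-1}, (e_1+⋯+e_n)/2) ⊂ ℝ^n`. -/
noncomputable def Dstar (n : ℕ) : AddSubgroup (E n) :=
  (Submodule.span ℤ
    ({x : E n | ∃ i : Fin n, (i : ℕ) < n - 1 ∧ x = EuclideanSpace.single i 1} ∪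
     {(2⁻¹ : ℝ) • ∑ i : Fin n, EuclideanSpace.single i (1 : ℝ)})).toAddSubgroup

namespace Dstar

/-- All coordinates of `w` are integers. -/
def IsIntegral {n : ℕ} (w : E n) : Prop := ∀ i, ∃ z : ℤ, w i = z

/-- All coordinates of `w` are half-odd integers. -/
def IsHalfIntegral {n : ℕ} (w : E n) : Prop := ∀ i, ∃ z : ℤ, w i = z + 1 / 2

/-- The vector `(1/2, …, 1/2)`. -/
def halfVec (n : ℕ) : E n := (2⁻¹ : ℝ) • ∑ i : Fin n, EuclideanSpace.single i (1 : ℝ)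

lemma halfVec_apply {n : ℕ} (i : Fin n) : halfVec n i = 1 / 2 := by
  simp [halfVec, Pi.single_apply]

lemma norm_sq_halfVec (n : ℕ) : ‖halfVec n‖ ^ 2 = (n : ℝ) / 4 := by
  rw [EuclideanSpace.real_norm_sq_eq]
  simp only [halfVec_apply, Finset.sum_const, Finset.card_univ, Fintype.card_fin, nsmul_eq_mul]
  ring

lemma eq_sum_single {n : ℕ} (w : E n) :
    w = ∑ i, w i • (EuclideanSpace.single i 1 : E n) := by
  ext j
  simp [Pi.single_apply]

lemma halfVec_mem (n : ℕ) : halfVec n ∈ Dstar n :=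
  Submodule.subset_span (Or.inr rfl)

lemma intCast_smul_mem {n : ℕ} {w : E n} (hw : w ∈ Dstar n) (z : ℤ) : (z : ℝ) • w ∈ Dstar n := by
  rw [Int.cast_smul_eq_zsmul]
  exact (Dstar n).zsmul_mem hw z

lemma single_mem {n : ℕ} (i : Fin n) : (EuclideanSpace.single i 1 : E n) ∈ Dstar n := by
  have small : ∀ j : Fin n, (j : ℕ) < n - 1 → (EuclideanSpace.single j 1 : E n) ∈ Dstar n :=
    fun j hj => Submodule.subset_span (Or.inl ⟨j, hj, rfl⟩)
  by_cases hi : (i : ℕ) < n - 1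
  · exact small i hi
  have key : (EuclideanSpace.single i 1 : E n) =
      ((2 : ℤ) : ℝ) • halfVec n - ∑ j ∈ Finset.univ.erase i, EuclideanSpace.single j 1 := by
    rw [halfVec, ← Finset.add_sum_erase _ _ (Finset.mem_univ i), smul_smul]
    norm_num
  rw [key]
  refine (Dstar n).sub_mem (intCast_smul_mem (halfVec_mem n) 2) ((Dstar n).sum_mem fun j hj => ?_)
  have hne : (j : ℕ) ≠ i := fun h => Finset.ne_of_mem_erase hj (Fin.ext h)
  exact small j (by omega)

lemma mem_of_isIntegral {n : ℕ} {w : E n} (hw : IsIntegral w) : w ∈ Dstar n := by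
  rw [eq_sum_single w]
  refine (Dstar n).sum_mem fun i _ => ?_
  obtain ⟨z, hz⟩ := hw i
  rw [hz]
  exact intCast_smul_mem (single_mem i) z

lemma isIntegral_or_isHalfIntegral {n : ℕ} {w : E n} (hw : w ∈ Dstar n) :
    IsIntegral w ∨ IsHalfIntegral w := by
  have key : ∃ a : ℤ, ∀ i, ∃ z : ℤ, w i = (z : ℝ) + (a : ℝ) / 2 := by
    refine Submodule.span_induction
      (p := fun (w : E n) _ => ∃ a : ℤ, ∀ i, ∃ z : ℤ, w i = (z : ℝ) + (a : ℝ) / 2)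
      ?_ ?_ ?_ ?_ hw
    · rintro x (⟨i, -, rfl⟩ | rfl)
      · refine ⟨0, fun j => ⟨if j = i then 1 else 0, ?_⟩⟩
        simp
      · exact ⟨1, fun j => ⟨0, by simp⟩⟩
    · exact ⟨0, fun j => ⟨0, by simp⟩⟩
    · rintro x y - - ⟨a, ha⟩ ⟨b, hb⟩
      refine ⟨a + b, fun j => ?_⟩
      obtain ⟨s, hs⟩ := ha j
      obtain ⟨t, ht⟩ := hb j
      exact ⟨s + t, by rw [PiLp.add_apply, hs, ht]; push_cast; ring⟩
    · rintro c x - ⟨a, ha⟩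
      refine ⟨c * a, fun j => ?_⟩
      obtain ⟨s, hs⟩ := ha j
      refine ⟨c * s, ?_⟩
      rw [← Int.cast_smul_eq_zsmul ℝ, PiLp.smul_apply, hs]
      push_cast
      rw [smul_eq_mul]
      ring
  obtain ⟨a, ha⟩ := key
  obtain ⟨b, hb | hb⟩ := Int.even_or_odd' a
  · refine Or.inl fun i => ?_
    obtain ⟨z, hz⟩ := ha i
    exact ⟨z + b, by rw [hz, hb]; push_cast; ring⟩
  · refine Or.inr fun i => ?_
    obtain ⟨z, hz⟩ := ha i
    exact ⟨z + b, by rw [hz, hb]; push_cast; ring⟩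

lemma IsHalfIntegral.apply_ne_zero {n : ℕ} {w : E n} (hw : IsHalfIntegral w) (i : Fin n) :
    w i ≠ 0 := by
  obtain ⟨z, hz⟩ := hw i
  intro h
  have h2 : (2 * z + 1 : ℝ) = 0 := by linarith
  have h3 : 2 * z + 1 = 0 := by exact_mod_cast h2
  omega

lemma IsHalfIntegral.le_norm_sq {n : ℕ} {w : E n} (hw : IsHalfIntegral w) :
    (n : ℝ) / 4 ≤ ‖w‖ ^ 2 := by
  rw [← norm_sq_halfVec, EuclideanSpace.real_norm_sq_eq, EuclideanSpace.real_norm_sq_eq]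
  refine Finset.sum_le_sum fun i _ => ?_
  rw [halfVec_apply]
  obtain ⟨z, hz⟩ := hw i
  have h : (0 : ℝ) ≤ z * (z + 1) := by
    have : 0 ≤ z * (z + 1) := by
      obtain h | h := le_or_gt 0 z <;> nlinarith
    exact_mod_cast this
  rw [hz]
  nlinarith

lemma IsIntegral.eq_single_of_norm_le_one {n : ℕ} {w : E n} (hw : IsIntegral w) (h0 : w ≠ 0)
    (h1 : ‖w‖ ≤ 1) :
    ∃ k, w = EuclideanSpace.single k 1 ∨ w = -EuclideanSpace.single k 1 := by
  obtain ⟨k, hk⟩ : ∃ k, w k ≠ 0 := by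
    by_contra! h
    exact h0 (by ext i; simpa using h i)
  choose z hz using hw
  have hsum : ∑ i, (w i) ^ 2 ≤ 1 := by
    rw [← EuclideanSpace.real_norm_sq_eq]
    nlinarith [norm_nonneg w]
  have hsumz : ∑ i, (z i) ^ 2 ≤ 1 := by
    simp only [hz] at hsum
    exact_mod_cast hsum
  rw [← Finset.add_sum_erase _ _ (Finset.mem_univ k)] at hsumz
  have hzk : z k ≠ 0 := fun h => hk (by rw [hz, h, Int.cast_zero])
  have hk1 : 1 ≤ (z k) ^ 2 := by have := sq_pos_of_ne_zero hzk; omega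
  have hrest : ∑ i ∈ Finset.univ.erase k, (z i) ^ 2 = 0 :=
    le_antisymm (by omega) (Finset.sum_nonneg fun i _ => sq_nonneg _)
  have hother : ∀ i, i ≠ k → z i = 0 := fun i hi => by
    have := (Finset.sum_eq_zero_iff_of_nonneg (fun i _ => sq_nonneg (z i))).1 hrest i
      (Finset.mem_erase.2 ⟨hi, Finset.mem_univ i⟩)
    exact pow_eq_zero_iff (two_ne_zero) |>.1 this
  have hsq : z k ^ 2 = 1 := by omega
  refine ⟨k, ?_⟩
  obtain h | h := sq_eq_sq_iff_eq_or_eq_neg.1 (hsq.trans (one_pow 2).symm)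
  · refine Or.inl ?_
    ext i
    obtain rfl | hi := eq_or_ne i k
    · simp [hz, h]
    · simp [hz, hother i hi, hi]
  · refine Or.inr ?_
    ext i
    obtain rfl | hi := eq_or_ne i k
    · simp [hz, h]
    · simp [hz, hother i hi, hi]

lemma one_le_norm {n : ℕ} (hn : 5 ≤ n) {w : E n} (hw : w ∈ Dstar n) (h0 : w ≠ 0) : 1 ≤ ‖w‖ := by
  by_contra! h1
  obtain h | h := isIntegral_or_isHalfIntegral hw
  · obtain ⟨k, rfl | rfl⟩ := h.eq_single_of_norm_le_one h0 h1.le <;> simp at h1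
  · have h4 := h.le_norm_sq
    have hn' : (5 : ℝ) ≤ n := by exact_mod_cast hn
    nlinarith [norm_nonneg w]

lemma linearIndependent_single (n : ℕ) :
    LinearIndependent ℝ (fun i : Fin n => (EuclideanSpace.single i 1 : E n)) :=
  (EuclideanSpace.orthonormal_single (𝕜 := ℝ) (ι := Fin n)).linearIndependent

lemma succMin_eq_one {n : ℕ} (hn : 5 ≤ n) {i : ℕ} (hi1 : 1 ≤ i) (hin : i ≤ n) :
    succMin (Dstar n) i = 1 := by
  refine IsLeast.csInf_eq ⟨⟨zero_le_one, fun j => EuclideanSpace.single (Fin.castLE hin j) 1,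
    fun j => single_mem _, ?_, fun j => by simp⟩, ?_⟩
  · exact (linearIndependent_single n).comp _ (Fin.castLE_injective hin)
  · rintro r ⟨-, v, hv, hli, hr⟩
    exact (one_le_norm hn (hv ⟨0, hi1⟩) (hli.ne_zero _)).trans (hr _)

lemma span_real_eq_top_of_isLatticeBasis {n : ℕ} {v : Fin n → E n}
    (hv : IsLatticeBasis (Dstar n) v) : ⊤ ≤ Submodule.span ℝ (Set.range v) := by
  intro w _
  rw [eq_sum_single w]
  refine Submodule.sum_mem _ fun i _ => Submodule.smul_mem _ _ ?_
  have h : (EuclideanSpace.single i 1 : E n) ∈ (Submodule.span ℤ (Set.range v) : Set (E n)) := by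
    rw [hv.2]
    exact single_mem i
  exact Submodule.span_le_restrictScalars ℤ ℝ _ h

lemma linearIndependent_of_isLatticeBasis {n : ℕ} {v : Fin n → E n}
    (hv : IsLatticeBasis (Dstar n) v) : LinearIndependent ℝ v :=
  linearIndependent_of_top_le_span_of_card_eq_finrank (span_real_eq_top_of_isLatticeBasis hv)
    (by simp)

lemma apply_eq_zero_of_mem_span {n : ℕ} {s : Set (E n)} {l : Fin n} (hs : ∀ x ∈ s, x l = 0)
    {w : E n} (hw : w ∈ Submodule.span ℝ s) : w l = 0 := by
  induction hw using Submodule.span_induction with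
  | mem x hx => exact hs x hx
  | zero => simp
  | add x y _ _ hx hy => simp [hx, hy]
  | smul c x _ hx => simp [hx]

/-- To extend the first `i` vectors of a lattice basis by `w` to a primitive tuple, it suffices
that some coordinate `l` vanishes on them but not on `w`, and that they generate with `w` all
lattice vectors of their real span. -/
lemma isPrimitiveTuple_snoc {n : ℕ} {v : Fin n → E n} (hv : IsLatticeBasis (Dstar n) v)
    {i l : Fin n} (hl : ∀ j, truncTuple v i j l = 0) {w : E n} (hw : w ∈ Dstar n)
    (hwl : w l ≠ 0)
    (hspan : ∀ x ∈ Dstar n, x ∈ Submodule.span ℝ (insert w (Set.range (truncTuple v i))) →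
      x ∈ Submodule.span ℤ (insert w (Set.range (truncTuple v i)))) :
    IsPrimitiveTuple (Dstar n) (Fin.snoc (truncTuple v i) w : Fin (i + 1) → E n) := by
  have hmem : ∀ j, (Fin.snoc (truncTuple v i) w : Fin (i + 1) → E n) j ∈ Dstar n := by
    refine Fin.lastCases ?_ fun j => ?_
    · simpa using hw
    · rw [Fin.snoc_castSucc]
      exact hv.1 (Fin.castLE i.isLt.le j)
  refine ⟨hmem, linearIndependent_finSnoc.2 ⟨?_, fun h => hwl ?_⟩, ?_⟩
  · exact (linearIndependent_of_isLatticeBasis hv).comp _ (Fin.castLE_injective _)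
  · refine apply_eq_zero_of_mem_span ?_ h
    rintro _ ⟨j, rfl⟩
    exact hl j
  · refine Set.Subset.antisymm (fun x hx => ⟨?_, ?_⟩) ?_
    · exact Submodule.span_le_restrictScalars ℤ ℝ _ hx
    · have hle : Submodule.span ℤ (Set.range (Fin.snoc (truncTuple v i) w : Fin (i + 1) → E n)) ≤
          AddSubgroup.toIntSubmodule (Dstar n) := by
        rw [Submodule.span_le]
        rintro _ ⟨j, rfl⟩
        exact hmem j
      exact hle hx
    · rintro x ⟨hx, hxL⟩
      rw [Fin.range_snoc] at hx ⊢
      exact hspan x hxL hx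

/-- If the first `i` vectors of a family are `±` standard basis vectors, then they generate the
integral vectors supported on a set of at most `i` coordinates. -/
lemma exists_support {n : ℕ} {v : Fin n → E n} {i : Fin n}
    (hu : ∀ j < i, ∃ k, v j = EuclideanSpace.single k 1 ∨ v j = -EuclideanSpace.single k 1) :
    ∃ T : Finset (Fin n), T.card ≤ i ∧ (∀ l ∉ T, ∀ j, truncTuple v i j l = 0) ∧
      ∀ l ∈ T, (EuclideanSpace.single l 1 : E n) ∈
        Submodule.span ℤ (Set.range (truncTuple v i)) := by
  have hu' : ∀ j, ∃ k, truncTuple v i j = EuclideanSpace.single k 1 ∨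
      truncTuple v i j = -EuclideanSpace.single k 1 := fun j => hu _ j.isLt
  choose k hk using hu'
  refine ⟨Finset.univ.image k, ?_, fun l hl j => ?_, fun l hl => ?_⟩
  · simpa using Finset.card_image_le (s := Finset.univ) (f := k)
  · have hne : l ≠ k j := fun h => hl (Finset.mem_image.2 ⟨j, Finset.mem_univ j, h.symm⟩)
    obtain h | h := hk j <;> simp [h, hne]
  · obtain ⟨j, -, rfl⟩ := Finset.mem_image.1 hl
    have hj : truncTuple v i j ∈ Submodule.span ℤ (Set.range (truncTuple v i)) :=
      Submodule.subset_span ⟨j, rfl⟩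
    obtain h | h := hk j
    · rwa [← h]
    · rw [← neg_eq_iff_eq_neg.2 h]
      exact Submodule.neg_mem _ hj

lemma eq_single_of_isMinkowskiReduced {n : ℕ} (hn : 5 ≤ n) {v : Fin n → E n}
    (hv : IsMinkowskiReduced (Dstar n) v) (i : Fin n) (hi : (i : ℕ) < n - 1) :
    ∃ k, v i = EuclideanSpace.single k 1 ∨ v i = -EuclideanSpace.single k 1 := by
  induction i using WellFoundedLT.induction with
  | ind i ih =>
  obtain ⟨T, hcard, hT0, hT⟩ := exists_support fun j (hj : j < i) => ih j hj (by omega)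
  obtain ⟨l, hl⟩ : ∃ l, l ∉ T := by
    by_contra! h
    rw [Finset.eq_univ_iff_forall.2 h, Finset.card_univ, Fintype.card_fin] at hcard
    omega
  obtain ⟨m, hm⟩ : ∃ m, m ∉ insert l T := by
    by_contra! h
    have := Finset.card_insert_le l T
    rw [Finset.eq_univ_iff_forall.2 h, Finset.card_univ, Fintype.card_fin] at this
    omega
  have hprim : IsPrimitiveTuple (Dstar n)
      (Fin.snoc (truncTuple v i) (EuclideanSpace.single l 1) : Fin (i + 1) → E n) := by
    refine isPrimitiveTuple_snoc hv.1 (hT0 l hl) (single_mem l) (by simp) fun x hxL hx => ?_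
    have hzero : ∀ p ∉ insert l T, x p = 0 := by
      refine fun p hp => apply_eq_zero_of_mem_span ?_ hx
      rw [Finset.mem_insert, not_or] at hp
      rintro _ (rfl | ⟨j, rfl⟩)
      · simp [hp.1]
      · exact hT0 p hp.2 j
    have hint : IsIntegral x := (isIntegral_or_isHalfIntegral hxL).resolve_right
      fun h => h.apply_ne_zero m (hzero m hm)
    rw [eq_sum_single x]
    refine Submodule.sum_mem _ fun p _ => ?_
    by_cases hp : p ∈ insert l T
    · obtain ⟨z, hz⟩ := hint p
      rw [hz, Int.cast_smul_eq_zsmul]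
      refine Submodule.smul_mem _ _ ?_
      obtain rfl | hp := Finset.mem_insert.1 hp
      · exact Submodule.subset_span (Set.mem_insert _ _)
      · exact Submodule.span_mono (Set.subset_insert _ _) (hT p hp)
    · rw [hzero p hp, zero_smul]
      exact Submodule.zero_mem _
  have hle : ‖v i‖ ≤ 1 := by simpa using hv.2 i _ (single_mem l) hprim
  have hint : IsIntegral (v i) := by
    refine (isIntegral_or_isHalfIntegral (hv.1.1 i)).resolve_right fun h => ?_
    have h4 := h.le_norm_sq
    have hn' : (5 : ℝ) ≤ n := by exact_mod_cast hn
    nlinarith [norm_nonneg (v i)]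
  exact hint.eq_single_of_norm_le_one ((linearIndependent_of_isLatticeBasis hv.1).ne_zero i) hle

lemma norm_sq_last_of_isMinkowskiReduced {n : ℕ} (hn : 5 ≤ n) {v : Fin n → E n}
    (hv : IsMinkowskiReduced (Dstar n) v) {i : Fin n} (hi : (i : ℕ) = n - 1) :
    ‖v i‖ ^ 2 = (n : ℝ) / 4 := by
  have hunit := fun j (hj : j < i) => eq_single_of_isMinkowskiReduced hn hv j (by omega)
  have hcases : ∀ j, j < i ∨ j = i := fun j => by omega
  obtain ⟨T, hcard, hT0, -⟩ := exists_support hunit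
  obtain ⟨l, hl⟩ : ∃ l, l ∉ T := by
    by_contra! h
    rw [Finset.eq_univ_iff_forall.2 h, Finset.card_univ, Fintype.card_fin] at hcard
    omega
  have hlt : ∀ j < i, v j l = 0 := fun j hj => hT0 l hl ⟨j, hj⟩
  have hexp : ∀ x ∈ Dstar n, ∃ c : Fin n → ℤ, ∑ j, c j • v j = x := fun x hx => by
    have hx' : x ∈ (Submodule.span ℤ (Set.range v) : Set (E n)) := by rwa [hv.1.2]
    exact (Submodule.mem_span_range_iff_exists_fun ℤ).1 hx'
  have hcoord : ∀ c : Fin n → ℤ, (∑ j, c j • v j) l = c i * v i l := fun c => by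
    rw [WithLp.ofLp_sum, Finset.sum_apply, Finset.sum_eq_single i]
    · simp
    · intro j _ hj
      simp [hlt j ((hcases j).resolve_right hj)]
    · simp
  have hvl : v i l ≠ 0 := fun h => by
    obtain ⟨c, hc⟩ := hexp _ (halfVec_mem n)
    have := hcoord c
    rw [hc, halfVec_apply, h] at this
    norm_num at this
  have hhalf : IsHalfIntegral (v i) := by
    refine (isIntegral_or_isHalfIntegral (hv.1.1 i)).resolve_left fun hint => ?_
    obtain ⟨c, hc⟩ := hexp _ (halfVec_mem n)
    obtain ⟨z, hz⟩ := hint l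
    have h := hcoord c
    rw [hc, halfVec_apply, hz] at h
    have h2 : (1 : ℝ) = 2 * (c i * z) := by linarith
    have h3 : (1 : ℤ) = 2 * (c i * z) := by exact_mod_cast h2
    omega
  have hprim : IsPrimitiveTuple (Dstar n)
      (Fin.snoc (truncTuple v i) (halfVec n) : Fin (i + 1) → E n) := by
    refine isPrimitiveTuple_snoc hv.1 (hT0 l hl) (halfVec_mem n) (by simp [halfVec_apply])
      fun x hxL _ => ?_
    obtain ⟨a, ha⟩ : ∃ a : ℤ, x l = a / 2 := by
      obtain h | h := isIntegral_or_isHalfIntegral hxL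
      · obtain ⟨z, hz⟩ := h l
        exact ⟨2 * z, by rw [hz]; push_cast; ring⟩
      · obtain ⟨z, hz⟩ := h l
        exact ⟨2 * z + 1, by rw [hz]; push_cast; ring⟩
    obtain ⟨c, hc⟩ := hexp (x - a • halfVec n)
      ((Dstar n).sub_mem hxL ((Dstar n).zsmul_mem (halfVec_mem n) a))
    have hci : c i = 0 := by
      have h := hcoord c
      rw [hc] at h
      have h0 : (x - a • halfVec n) l = 0 := by
        simp [halfVec_apply, ha]
        ring
      rw [h0] at h
      exact Int.cast_eq_zero.1 ((mul_eq_zero.1 h.symm).resolve_right hvl)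
    rw [← sub_add_cancel x (a • halfVec n), ← hc]
    refine Submodule.add_mem _ (Submodule.sum_mem _ fun j _ => ?_)
      (Submodule.smul_mem _ _ (Submodule.subset_span (Set.mem_insert _ _)))
    obtain hj | rfl := hcases j
    · exact Submodule.smul_mem _ _
        (Submodule.subset_span (Set.mem_insert_of_mem _ ⟨⟨j, hj⟩, rfl⟩))
    · rw [hci, zero_smul]
      exact Submodule.zero_mem _
  refine le_antisymm ?_ hhalf.le_norm_sq
  rw [← norm_sq_halfVec]
  exact pow_le_pow_left₀ (norm_nonneg _) (hv.2 i _ (halfVec_mem n) hprim) 2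

end Dstar

/-- For `n ≥ 5`: every nonzero vector of `D_n^*` has norm at least 1,
`λ_i(D_n^*) = 1` for `1 ≤ i ≤ n`, and every Minkowski-reduced basis `v` of `D_n^*` satisfies
`‖v_n‖² = n/4 = (n/4)·λ_n(D_n^*)²`. -/
theorem Dstar_minkowski_last_vector (n : ℕ) (hn : 5 ≤ n) :
    (∀ w ∈ Dstar n, w ≠ 0 → 1 ≤ ‖w‖) ∧
    (∀ i : ℕ, 1 ≤ i → i ≤ n → succMin (Dstar n) i = 1) ∧
    ∀ v : Fin n → E n, IsMinkowskiReduced (Dstar n) v →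
      ‖v ⟨n - 1, by omega⟩‖ ^ 2 = (n : ℝ) / 4 ∧
      (n : ℝ) / 4 = ((n : ℝ) / 4) * (succMin (Dstar n) n) ^ 2 := by
  have hmin := @Dstar.succMin_eq_one n hn
  refine ⟨fun w => Dstar.one_le_norm hn, fun i => hmin, fun v hv => ⟨?_, ?_⟩⟩
  · exact Dstar.norm_sq_last_of_isMinkowskiReduced hn hv rfl
  · rw [hmin (by omega) le_rfl, one_pow, mul_one]
end
end
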